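/- arXiv:2112.12588 — 2 statements merged into one kernel-verified Lean document; each statement's English description precedes it below -/
import Mathlib

section
/- Let S be a Cohen–Macaulay Noetherian ring, let I be an unmixed ideal of S of height c that is generically a complete intersection, and let m be a positive integer. If p is an associated prime of S/I^m that is not an associated prime of S/I, then p contains the c-th Fitting ideal F_c(I); equivalently, the minimal number of generators of I S_p exceeds c. -/
open Ideal Filter

universe u

/-- The `m`-th symbolic power of an ideal `I`: the intersection, over all associated primes `p`
of `S ⧸ I`, of the contractions of `I ^ m` extended to the localization at `p`. -/
noncomputable def symbolicPower {S : Type*} [CommRing S] (I : Ideal S) (m : ℕ) : Ideal S :=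
  ⨅ p : associatedPrimes S (S ⧸ I),
    letI : p.1.IsPrime := p.2.isPrime
    ((I ^ m).map (algebraMap S (Localization.AtPrime p.1))).comap
      (algebraMap S (Localization.AtPrime p.1))

/-- The height of an ideal: the infimum of the heights of the primes containing it. -/
noncomputable def idealHeight {S : Type*} [CommRing S] (I : Ideal S) : ℕ∞ :=
  ⨅ (p : PrimeSpectrum S) (_ : I ≤ p.asIdeal), Order.height p

/-- An ideal is unmixed of height `c` if it has height `c` and every associated prime of `S ⧸ I`
has height `c`. -/
def IsUnmixedOfHeight {S : Type*} [CommRing S] (I : Ideal S) (c : ℕ) : Prop :=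
  idealHeight I = (c : ℕ∞) ∧ ∀ p ∈ associatedPrimes S (S ⧸ I), idealHeight p = (c : ℕ∞)

/-- An ideal `I` is generically a complete intersection if, for every associated prime `p` of
`S ⧸ I`, the extension of `I` to the localization at `p` is generated by a regular sequence. -/
def IsGenericallyCI {S : Type*} [CommRing S] (I : Ideal S) : Prop :=
  ∀ p : associatedPrimes S (S ⧸ I),
    letI : p.1.IsPrime := p.2.isPrime
    ∃ rs : List (Localization.AtPrime p.1),
      RingTheory.Sequence.IsRegular (Localization.AtPrime p.1) rs ∧
      Ideal.ofList rs = I.map (algebraMap S (Localization.AtPrime p.1))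

/-- The depth of a local ring: the supremum of lengths of regular sequences contained in the
maximal ideal. -/
noncomputable def localDepth (R : Type*) [CommRing R] [IsLocalRing R] : ℕ∞ :=
  ⨆ rs : {rs : List R // (∀ x ∈ rs, x ∈ IsLocalRing.maximalIdeal R) ∧
      RingTheory.Sequence.IsRegular R rs}, (rs.1.length : ℕ∞)

/-- A ring is Cohen-Macaulay if the localization at every prime ideal has depth equal to its
Krull dimension. -/
def IsCohenMacaulayRing (S : Type*) [CommRing S] : Prop :=
  ∀ (p : Ideal S) (_hp : p.IsPrime),
    (localDepth (Localization.AtPrime p) : WithBot ℕ∞) = ringKrullDim (Localization.AtPrime p)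

/-- The `j`-th Fitting ideal of a module `M`: the ideal generated by the `(n - j)`-minors of a
presentation matrix coming from any generating family of size `n`. -/
noncomputable def fittingIdeal (S : Type*) [CommRing S] (M : Type*) [AddCommGroup M]
    [Module S M] (j : ℕ) : Ideal S :=
  ⨆ (n : ℕ) (g : Fin n → M) (_ : Submodule.span S (Set.range g) = ⊤),
    Ideal.span { d : S | ∃ (r : Fin (n - j) → Fin n → S) (ι : Fin (n - j) → Fin n),
      (∀ k, ∑ i, r k i • g i = 0) ∧ d = Matrix.det (Matrix.of fun k l => r l (ι k)) }

/-- The minimal number of generators of an ideal. -/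
noncomputable def minGens {R : Type*} [CommRing R] (I : Ideal R) : ℕ∞ :=
  sInf {n : ℕ∞ | ∃ (r : ℕ) (f : Fin r → R), Ideal.span (Set.range f) = I ∧ (r : ℕ∞) = n}

open RingTheory.Sequence IsLocalRing Pointwise

open CategoryTheory Abelian Limits in
/-- Cutting a finite module by a regular element lowers its depth by at most one. -/
lemma exists_isRegular_quotSMulTop {R : Type u} [CommRing R] [IsNoetherianRing R] [IsLocalRing R]
    {M : Type u} [AddCommGroup M] [Module R M] [Module.Finite R M] {y : R}
    (hy : y ∈ maximalIdeal R) (hreg : IsSMulRegular M y) {n : ℕ} {rs : List R}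
    (hlen : rs.length = n + 1) (hmem : ∀ r ∈ rs, r ∈ maximalIdeal R) (hrs : IsRegular M rs) :
    ∃ rs' : List R, rs'.length = n ∧ (∀ r ∈ rs', r ∈ maximalIdeal R) ∧
      IsRegular (QuotSMulTop y M) rs' := by
  have := hrs.nontrivial
  have hlt (L : Type u) [AddCommGroup L] [Module R L] [Module.Finite R L] [Nontrivial L] :
      maximalIdeal R • (⊤ : Submodule R L) < ⊤ :=
    (Submodule.top_ne_ideal_smul_of_le_jacobson_annihilator
      (maximalIdeal_le_jacobson _)).symm.lt_top
  have hntr : Nontrivial (QuotSMulTop y M) := nontrivial_quotSMulTop_of_mem_maximalIdeal _ hy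
  have supp : Module.support R (R ⧸ maximalIdeal R) = PrimeSpectrum.zeroLocus (maximalIdeal R) := by
    rw [Module.support_eq_zeroLocus, annihilator_quotient]
  have hext := ModuleCat.subsingleton_ext_of_exists_isRegular (maximalIdeal R)
    (ModuleCat.of R (R ⧸ maximalIdeal R)) supp.subset (ModuleCat.of R M) (hlt M) rs hmem hrs
  refine ModuleCat.exists_isRegular_of_exists_subsingleton_ext (maximalIdeal R) n
    (ModuleCat.of R (QuotSMulTop y M)) (hlt _) (ModuleCat.of R (R ⧸ maximalIdeal R)) supp
    fun i hi ↦ ?_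
  have zero1 := AddCommGrpCat.isZero_of_iff_subsingleton.mpr (hext i (by omega))
  have zero2 := AddCommGrpCat.isZero_of_iff_subsingleton.mpr (hext (i + 1) (by omega))
  have hreg' : IsSMulRegular (ModuleCat.of R M) y := hreg
  exact AddCommGrpCat.subsingleton_of_isZero <| ShortComplex.Exact.isZero_of_both_zeros
    ((Ext.covariant_sequence_exact₃' (ModuleCat.of R (R ⧸ maximalIdeal R))
      hreg'.smulShortComplex_shortExact) i (i + 1) rfl)
    (zero1.eq_zero_of_src _) (zero2.eq_zero_of_tgt _)

/-- The length of a regular sequence on `M` is at most the dimension of the support of any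
nonzero finite module embedding into `M`. -/
lemma length_le_supportDim_of_injective {R : Type*} [CommRing R] [IsNoetherianRing R]
    [IsLocalRing R] {M N : Type*} [AddCommGroup M] [Module R M] [Module.Finite R M]
    [AddCommGroup N] [Module R N] [Nontrivial N] (f : N →ₗ[R] M)
    (hf : Function.Injective f) {rs : List R} (hmem : ∀ r ∈ rs, r ∈ maximalIdeal R)
    (hrs : IsWeaklyRegular M rs) : (rs.length : WithBot ℕ∞) ≤ Module.supportDim R N := by
  suffices H : ∀ (M : Type _) [AddCommGroup M] [Module R M] [Module.Finite R M] (N : Submodule R M),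
      N ≠ ⊥ → IsWeaklyRegular M rs → (rs.length : WithBot ℕ∞) ≤ Module.supportDim R N by
    rw [Module.supportDim_eq_of_equiv (LinearEquiv.ofInjective f hf)]
    refine H M _ ?_ hrs
    intro h
    obtain ⟨x, hx⟩ := exists_ne (0 : N)
    rw [LinearMap.range_eq_bot] at h
    exact hx (hf (by simp [h]))
  clear hrs
  induction rs with
  | nil =>
    intro M _ _ _ N hN _
    have : Nontrivial N := Submodule.nontrivial_iff_ne_bot.mpr hN
    have := Module.supportDim_ne_bot_of_nontrivial R N
    generalize Module.supportDim R N = d at this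
    cases d with
    | bot => exact absurd rfl this
    | coe d => simp
  | cons x rs ih =>
    intro M _ _ _ N hN hrs
    rw [isWeaklyRegular_cons_iff] at hrs
    have hx : x ∈ maximalIdeal R := hmem x (by simp)
    set A := Module.annihilator R N with hA
    let P : Submodule R M := Submodule.torsionBySet R M A
    have hNP : N ≤ P := by
      intro n hn
      simp only [P, Submodule.mem_torsionBySet_iff]
      rintro ⟨a, ha⟩
      have := Module.mem_annihilator.mp ha ⟨n, hn⟩
      simpa [Subtype.ext_iff] using this
    have hAP : A ≤ Module.annihilator R P := by
      intro a ha
      rw [Module.mem_annihilator]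
      rintro ⟨m, hm⟩
      simp only [P, Submodule.mem_torsionBySet_iff] at hm
      exact Subtype.ext (hm ⟨a, ha⟩)
    have hdim : Module.supportDim R P ≤ Module.supportDim R N := by
      rw [Module.supportDim_eq_ringKrullDim_quotient_annihilator,
        Module.supportDim_eq_ringKrullDim_quotient_annihilator]
      exact ringKrullDim_le_of_surjective (Ideal.Quotient.factor hAP)
        (Ideal.Quotient.factor_surjective hAP)
    have hP : P ≠ ⊥ := fun h ↦ hN (by simpa [h] using hNP)
    have : Nontrivial P := Submodule.nontrivial_iff_ne_bot.mpr hP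
    have hregP : IsSMulRegular P x := fun a b h ↦
      Subtype.ext (hrs.1 (by simpa using congrArg Subtype.val h))
    have hquot := Module.supportDim_quotSMulTop_succ_eq_supportDim hregP hx
    let g := QuotSMulTop.map x P.subtype
    have hg : Function.Injective g := by
      rw [← LinearMap.ker_eq_bot, LinearMap.ker_eq_bot']
      intro m hm
      obtain ⟨m, rfl⟩ := Submodule.Quotient.mk_surjective _ m
      have hm' : (Submodule.Quotient.mk (m : M) : QuotSMulTop x M) = 0 := hm
      rw [Submodule.Quotient.mk_eq_zero, Submodule.mem_smul_pointwise_iff_exists] at hm'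
      obtain ⟨b, -, hb⟩ := hm'
      have hbP : b ∈ P := by
        simp only [P, Submodule.mem_torsionBySet_iff]
        intro a
        apply hrs.1
        have := m.2
        simp only [P, Submodule.mem_torsionBySet_iff] at this
        simp only [smul_zero]
        rw [smul_comm, hb, this a]
      rw [Submodule.Quotient.mk_eq_zero, Submodule.mem_smul_pointwise_iff_exists]
      exact ⟨⟨b, hbP⟩, trivial, Subtype.ext hb⟩
    have hntr : Nontrivial (QuotSMulTop x P) := nontrivial_quotSMulTop_of_mem_maximalIdeal _ hx
    have hne : LinearMap.range g ≠ ⊥ := by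
      intro h
      obtain ⟨z, hz⟩ := exists_ne (0 : QuotSMulTop x P)
      rw [LinearMap.range_eq_bot] at h
      exact hz (hg (by simp [h]))
    have := ih (fun r hr ↦ hmem r (by simp [hr])) (QuotSMulTop x M) (LinearMap.range g) hne hrs.2
    rw [← Module.supportDim_eq_of_equiv (LinearEquiv.ofInjective g hg)] at this
    refine le_trans ?_ (hquot.le.trans hdim)
    simp only [List.length_cons, Nat.cast_add, Nat.cast_one]
    gcongr

/-- Cutting a finite module over a local ring by `n` elements of the maximal ideal lowers the
dimension of its support by at most `n`. -/
lemma supportDim_le_supportDim_quotient_ofList_add_length {R : Type*} [CommRing R]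
    [IsNoetherianRing R] [IsLocalRing R] {M : Type*} [AddCommGroup M] [Module R M]
    [Module.Finite R M] {ys : List R} (hys : ∀ y ∈ ys, y ∈ maximalIdeal R) :
    Module.supportDim R M ≤
      Module.supportDim R (M ⧸ (Ideal.ofList ys • ⊤ : Submodule R M)) + ys.length := by
  induction ys generalizing M with
  | nil =>
    rw [Ideal.ofList_nil, Submodule.bot_smul]
    simp [Module.supportDim_eq_of_equiv (Submodule.quotEquivOfEqBot (⊥ : Submodule R M) rfl)]
  | cons y ys ih =>
    rw [Module.supportDim_eq_of_equiv
      (Submodule.quotOfListConsSMulTopEquivQuotSMulTopInner M y ys)]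
    refine (Module.supportDim_le_supportDim_quotSMulTop_succ (hys y (by simp))).trans ?_
    simp only [List.length_cons, Nat.cast_add, Nat.cast_one, ← add_assoc]
    gcongr
    exact ih fun z hz ↦ hys z (by simp [hz])

/-- If `M` admits a regular sequence of length `n` and `ys` cuts the dimension of the support down
to at most `n - ys.length`, then `ys` is weakly regular on `M`. -/
lemma isWeaklyRegular_of_supportDim_add_length_le {R : Type u} [CommRing R] [IsNoetherianRing R]
    [IsLocalRing R] {M : Type u} [AddCommGroup M] [Module R M] [Module.Finite R M]
    {rs ys : List R} (hmem : ∀ r ∈ rs, r ∈ maximalIdeal R) (hrs : IsRegular M rs)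
    (hys : ∀ y ∈ ys, y ∈ maximalIdeal R)
    (hdim : Module.supportDim R (M ⧸ (Ideal.ofList ys • ⊤ : Submodule R M)) + ys.length ≤
      rs.length) : IsWeaklyRegular M ys := by
  induction ys generalizing M rs with
  | nil => exact .nil R M
  | cons y ys ih =>
    have hy : y ∈ maximalIdeal R := hys y (by simp)
    have hys' : ∀ z ∈ ys, z ∈ maximalIdeal R := fun z hz ↦ hys z (by simp [hz])
    have := hrs.nontrivial
    have hntr : Nontrivial (QuotSMulTop y M) := nontrivial_quotSMulTop_of_mem_maximalIdeal _ hy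
    rw [Module.supportDim_eq_of_equiv
      (Submodule.quotOfListConsSMulTopEquivQuotSMulTopInner M y ys)] at hdim
    simp only [List.length_cons, Nat.cast_add, Nat.cast_one, ← add_assoc] at hdim
    have hquot : Module.supportDim R (QuotSMulTop y M) + 1 ≤ rs.length := by
      refine le_trans ?_ hdim
      gcongr
      exact supportDim_le_supportDim_quotient_ofList_add_length hys'
    have hne := Module.supportDim_ne_bot_of_nontrivial R (QuotSMulTop y M)
    have hreg : IsSMulRegular M y := by
      by_contra hreg
      let K := LinearMap.ker (LinearMap.lsmul R M y)
      have hK : K ≠ ⊥ := fun h ↦ hreg (LinearMap.ker_eq_bot.mp h)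
      have : Nontrivial K := Submodule.nontrivial_iff_ne_bot.mpr hK
      have h1 := length_le_supportDim_of_injective K.subtype K.injective_subtype hmem hrs.1
      have h2 : Module.supportDim R K ≤ Module.supportDim R (QuotSMulTop y M) := by
        have hsub : Module.support R K ⊆ Module.support R (QuotSMulTop y M) := by
          rw [Module.support_quotSMulTop]
          refine Set.subset_inter
            (Module.support_subset_of_injective K.subtype K.injective_subtype) ?_
          rw [Module.support_eq_zeroLocus]
          refine PrimeSpectrum.zeroLocus_anti_mono ?_
          rw [Set.singleton_subset_iff, SetLike.mem_coe, Module.mem_annihilator]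
          exact fun k ↦ Subtype.ext k.2
        exact Order.krullDim_le_of_strictMono (fun a ↦ ⟨a.1, hsub a.2⟩) fun {_ _} lt ↦ lt
      have h3 := (add_le_add_left (h1.trans h2) 1).trans hquot
      norm_cast at h3
      omega
    cases hlen : rs.length with
    | zero =>
      rw [hlen] at hquot
      generalize Module.supportDim R (QuotSMulTop y M) = d at hquot hne
      cases d with
      | bot => exact absurd rfl hne
      | coe d => norm_cast at hquot; simp at hquot
    | succ n =>
      obtain ⟨rs', hlen', hmem', hrs'⟩ := exists_isRegular_quotSMulTop hy hreg hlen hmem hrs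
      refine .cons hreg (ih hmem' hrs' hys' ?_)
      rw [hlen] at hdim
      rw [hlen']
      generalize Module.supportDim R
        (QuotSMulTop y M ⧸ (Ideal.ofList ys • ⊤ : Submodule R (QuotSMulTop y M))) = d at hdim ⊢
      cases d with
      | bot => simp
      | coe d =>
        norm_cast at hdim ⊢
        cases d with
        | top => simp at hdim
        | coe d => norm_cast at hdim ⊢; omega

lemma sup_span_singleton_pow_succ {R : Type*} [CommRing R] (J : Ideal R) (a : R) (k : ℕ) :
    (J ⊔ Ideal.span {a}) ^ (k + 1) =
      J ^ (k + 1) ⊔ Ideal.span {a} * (J ⊔ Ideal.span {a}) ^ k := by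
  apply le_antisymm
  · induction k with
    | zero => simp
    | succ k ih =>
      rw [pow_succ' _ (k + 1), Ideal.sup_mul]
      refine sup_le ?_ le_sup_right
      refine (Ideal.mul_mono_right ih).trans ?_
      rw [Ideal.mul_sup, ← pow_succ']
      refine sup_le_sup_left ?_ _
      rw [mul_left_comm, pow_succ' _ k]
      exact Ideal.mul_mono_right (Ideal.mul_mono_left le_sup_left)
  · refine sup_le (Ideal.pow_right_mono le_sup_left _) ?_
    rw [pow_succ']
    exact Ideal.mul_mono_left le_sup_right

lemma mem_pow_of_mul_mem_pow_of_quasiRegular {R : Type*} [CommRing R] {J : Ideal R}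
    (hJ : ∀ K : Ideal R, J ≤ K → ∀ x : R, (∀ u, x * u ∈ K → u ∈ K) →
      ∀ (k : ℕ) (v : R), v ∈ J ^ k → x * v ∈ K * J ^ k → v ∈ K * J ^ k)
    {x : R} (hx : ∀ u, x * u ∈ J → u ∈ J) (k : ℕ) {u : R} (hu : x * u ∈ J ^ k) : u ∈ J ^ k := by
  induction k with
  | zero => simp
  | succ k ih =>
    rw [pow_succ'] at hu ⊢
    exact hJ J le_rfl x hx k u (ih (Ideal.mul_le_right hu)) hu

/-- Quasi-regularity of ideals generated by a weakly regular sequence. -/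
lemma mem_mul_pow_of_mul_mem_of_isWeaklyRegular {R : Type*} [CommRing R] {rs : List R}
    (hrs : IsWeaklyRegular R rs) (K : Ideal R) (hK : Ideal.ofList rs ≤ K) (x : R)
    (hx : ∀ u, x * u ∈ K → u ∈ K) (k : ℕ) (v : R) (hv : v ∈ Ideal.ofList rs ^ k)
    (hxv : x * v ∈ K * Ideal.ofList rs ^ k) : v ∈ K * Ideal.ofList rs ^ k := by
  induction rs using List.reverseRecOn generalizing K x k v with
  | nil =>
    cases k with
    | zero => simpa using hx v (by simpa using hxv)
    | succ k =>
      have : v = 0 := by simpa using hv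
      simp [this]
  | append_singleton rs a ih =>
    rw [isWeaklyRegular_append_iff] at hrs
    obtain ⟨hrs, ha⟩ := hrs
    rw [Ideal.ofList_append, Ideal.ofList_singleton] at hv hxv hK ⊢
    set J := Ideal.ofList rs with hJ
    have hJK : J ≤ K := le_sup_left.trans hK
    have haK : a ∈ K := hK (Ideal.mem_sup_right (Ideal.mem_span_singleton_self a))
    have ha' : ∀ u, a * u ∈ J → u ∈ J := by
      intro u hu
      have h1 := ((isWeaklyRegular_singleton_iff _ a).mp ha)
      have h2 : a • (Submodule.Quotient.mk u : R ⧸ (J • ⊤ : Submodule R R)) = 0 := by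
        rw [← Submodule.Quotient.mk_smul, Submodule.Quotient.mk_eq_zero]
        simpa using hu
      have := h1.right_eq_zero_of_smul h2
      rw [Submodule.Quotient.mk_eq_zero] at this
      simpa using this
    have hapow (k : ℕ) {u : R} (hu : a * u ∈ J ^ k) : u ∈ J ^ k :=
      mem_pow_of_mul_mem_pow_of_quasiRegular (ih hrs) ha' k hu
    have hJL (k : ℕ) : J ^ k ≤ (J ⊔ Ideal.span {a}) ^ k := Ideal.pow_right_mono le_sup_left _
    induction k generalizing v with
    | zero => simpa using hx v (by simpa using hxv)
    | succ k ihk =>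
      have hsup := sup_span_singleton_pow_succ J a k
      rw [hsup] at hv
      have hxv' := hxv
      rw [hsup, Ideal.mul_sup, mul_left_comm] at hxv'
      obtain ⟨v', hv', z, hz, rfl⟩ := Submodule.mem_sup.mp hv
      obtain ⟨w, hw, rfl⟩ := Ideal.mem_span_singleton_mul.mp hz
      obtain ⟨s, hs, z, hz, hst⟩ := Submodule.mem_sup.mp hxv'
      obtain ⟨t, ht, rfl⟩ := Ideal.mem_span_singleton_mul.mp hz
      have hKJ : K * J ^ (k + 1) ≤ J ^ (k + 1) := Ideal.mul_le_right
      have h1 : x * w - t ∈ J ^ (k + 1) := by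
        apply hapow
        have : a * (x * w - t) = s - x * v' := by linear_combination -hst
        rw [this]
        exact sub_mem (hKJ hs) (Ideal.mul_mem_left _ _ hv')
      have h2 : J ^ (k + 1) ≤ K * (J ⊔ Ideal.span {a}) ^ k := by
        rw [pow_succ']
        exact Ideal.mul_mono hJK (hJL k)
      have h3 : x * w ∈ K * (J ⊔ Ideal.span {a}) ^ k := by
        simpa using add_mem (h2 h1) ht
      have h4 := ihk w hw h3
      have haw : a * w ∈ K * (J ⊔ Ideal.span {a}) ^ (k + 1) := by
        rw [hsup, Ideal.mul_sup, mul_left_comm]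
        exact Ideal.mem_sup_right (Ideal.mem_span_singleton_mul.mpr ⟨w, h4, rfl⟩)
      refine add_mem ?_ haw
      refine Ideal.mul_mono_right (hJL (k + 1)) (ih hrs K hJK x hx (k + 1) v' hv' ?_)
      have h5 : t - x * w ∈ J ^ (k + 1) := by simpa using neg_mem h1
      have : x * v' = s + a * (t - x * w) := by linear_combination -hst
      rw [this]
      exact add_mem hs (Ideal.mul_mem_mul haK h5)

lemma ringKrullDim_quotient_add_height_le {R : Type*} [CommRing R] (J : Ideal R) :
    ringKrullDim (R ⧸ J) + J.height ≤ ringKrullDim R := by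
  rw [ringKrullDim_quotient, ringKrullDim]
  rcases isEmpty_or_nonempty (PrimeSpectrum.zeroLocus (J : Set R)) with h | h
  · simp [Order.krullDim_eq_bot]
  · have : Nonempty (PrimeSpectrum R) := h.map Subtype.val
    rw [Order.krullDim_eq_iSup_coheight_of_nonempty,
      Order.krullDim_eq_iSup_height_add_coheight_of_nonempty, ← WithBot.coe_add,
      WithBot.coe_le_coe, ENat.iSup_add]
    refine iSup_le fun q ↦ le_trans ?_ (le_iSup _ q.1)
    rw [add_comm, ← PrimeSpectrum.height_eq_orderHeight]
    exact add_le_add (Ideal.height_mono q.2)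
      (Order.coheight_le_coheight_apply_of_strictMono Subtype.val (fun _ _ h ↦ h) q)

lemma isWeaklyRegular_of_length_le_height {R : Type u} [CommRing R] [IsNoetherianRing R]
    [IsLocalRing R] (hCM : (localDepth R : WithBot ℕ∞) = ringKrullDim R) {ys : List R}
    (hys : ∀ y ∈ ys, y ∈ maximalIdeal R) (hht : (ys.length : ℕ∞) ≤ (Ideal.ofList ys).height) :
    IsWeaklyRegular R ys := by
  have hlt : localDepth R < ⊤ := by
    have := ringKrullDim_lt_top (R := R)
    rw [← hCM] at this
    exact WithBot.coe_lt_coe.mp this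
  have : Nonempty {rs : List R // (∀ x ∈ rs, x ∈ maximalIdeal R) ∧ IsRegular R rs} :=
    ⟨[], by simp, IsRegular.nil R R⟩
  obtain ⟨⟨rs, hmem, hrs⟩, hlen⟩ := ENat.exists_eq_iSup_of_lt_top hlt
  refine isWeaklyRegular_of_supportDim_add_length_le hmem hrs hys ?_
  have hdim : (rs.length : WithBot ℕ∞) = ringKrullDim R := by
    rw [← hCM, localDepth, ← hlen]
    rfl
  rw [smul_eq_mul, Ideal.mul_top, Module.supportDim_quotient_eq_ringKrullDim, hdim]
  refine le_trans ?_ (ringKrullDim_quotient_add_height_le (Ideal.ofList ys))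
  gcongr
  exact WithBot.coe_le_coe.mpr hht

lemma exists_le_mem_associatedPrimes_of_isWeaklyRegular {R : Type*} [CommRing R]
    [IsNoetherianRing R] {rs : List R} (hrs : IsWeaklyRegular R rs) {m : ℕ} {p : Ideal R}
    (hp : p ∈ associatedPrimes R (R ⧸ Ideal.ofList rs ^ m)) :
    ∃ q ∈ associatedPrimes R (R ⧸ Ideal.ofList rs), p ≤ q := by
  obtain ⟨hprime, x, hx⟩ := isAssociatedPrime_iff.mp hp
  obtain ⟨v, rfl⟩ := Ideal.Quotient.mk_surjective x
  have hpv (y : R) : y ∈ p ↔ y * v ∈ Ideal.ofList rs ^ m := by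
    rw [hx, Submodule.mem_colon_singleton, Submodule.mem_bot, Algebra.smul_def,
      ← Ideal.Quotient.eq_zero_iff_mem, map_mul]
    rfl
  have hv : v ∉ Ideal.ofList rs ^ m := fun h ↦
    hprime.ne_top ((Ideal.eq_top_iff_one _).mpr ((hpv 1).mpr (by simpa using h)))
  have hfin := associatedPrimes.finite R (R ⧸ Ideal.ofList rs)
  have hsub : (p : Set R) ⊆ ⋃ q ∈ (hfin.toFinset : Set (Ideal R)), (id q : Set R) := by
    simp only [Set.Finite.coe_toFinset, id]
    rw [biUnion_associatedPrimes_eq_zero_divisors]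
    intro y hy
    by_contra hne
    refine hv (mem_pow_of_mul_mem_pow_of_quasiRegular
      (mem_mul_pow_of_mul_mem_of_isWeaklyRegular hrs) (x := y) ?_ m ((hpv y).mp hy))
    intro u hu
    by_contra hu'
    refine hne ⟨Ideal.Quotient.mk _ u, by rwa [Ne, Ideal.Quotient.eq_zero_iff_mem], ?_⟩
    rw [Algebra.smul_def]
    exact Ideal.Quotient.eq_zero_iff_mem.mpr hu
  obtain ⟨q, hq, hpq⟩ := (Ideal.subset_union_prime ⊥ ⊥
    fun q hq _ _ ↦ ((hfin.mem_toFinset).mp hq).isPrime).mp hsub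
  exact ⟨q, hfin.mem_toFinset.mp hq, hpq⟩

lemma idealHeight_le_height {S : Type*} [CommRing S] (I : Ideal S) :
    idealHeight I ≤ I.height := by
  rw [Ideal.height_eq_inf_minimalPrimes]
  refine le_iInf₂ fun q hq ↦ ?_
  have := hq.isPrime
  rw [PrimeSpectrum.height_eq_orderHeight ⟨q, this⟩]
  exact iInf₂_le (f := fun (p : PrimeSpectrum S) (_ : I ≤ p.asIdeal) ↦ Order.height p)
    ⟨q, this⟩ hq.1.2

/-- Associated primes of cyclic modules are compatible with localization. -/
lemma mem_associatedPrimes_quotient_map_iff {S R : Type*} [CommRing S] [IsNoetherianRing S]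
    [CommRing R] [Algebra S R] (T : Submonoid S) [IsLocalization T R] (I : Ideal S) (P : Ideal R) :
    P ∈ associatedPrimes R (R ⧸ I.map (algebraMap S R)) ↔
      P.comap (algebraMap S R) ∈ associatedPrimes S (S ⧸ I) := by
  rw [← Ideal.localized'_eq_map R T I]
  rw [← Module.associatedPrimes.preimage_comap_associatedPrimes_eq_associatedPrimes_of_isLocalizedModule
    T R (Submodule.toLocalizedQuotient' R T (Algebra.linearMap S R) I), Set.mem_preimage]

lemma minGens_le_iff {R : Type*} [CommRing R] {I : Ideal R} {c : ℕ} :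
    minGens I ≤ c ↔ ∃ (r : ℕ) (f : Fin r → R), Ideal.span (Set.range f) = I ∧ r ≤ c := by
  constructor
  · intro h
    have hne : {n : ℕ∞ | ∃ (r : ℕ) (f : Fin r → R),
        Ideal.span (Set.range f) = I ∧ (r : ℕ∞) = n}.Nonempty := by
      by_contra hne
      rw [minGens, Set.not_nonempty_iff_eq_empty.mp hne] at h
      simp at h
    obtain ⟨r, f, hf, hr⟩ := csInf_mem hne
    refine ⟨r, f, hf, ?_⟩
    rw [minGens, ← hr] at h
    exact_mod_cast h
  · rintro ⟨r, f, hf, hr⟩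
    have h : minGens I ≤ r := sInf_le ⟨r, f, hf, rfl⟩
    exact h.trans (by exact_mod_cast hr)

lemma minGens_span_finset_image_le {R α : Type*} [CommRing R] (T : Finset α) (b : α → R) :
    minGens (Ideal.span (b '' T)) ≤ T.card := by
  refine minGens_le_iff.mpr ⟨T.card, fun j ↦ b (T.equivFin.symm j), ?_, le_rfl⟩
  congr 1
  ext x
  constructor
  · rintro ⟨j, rfl⟩
    exact ⟨_, (T.equivFin.symm j).2, rfl⟩
  · rintro ⟨i, hi, rfl⟩
    exact ⟨T.equivFin ⟨i, hi⟩, by simp⟩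

/-- Cramer's rule for relations: the determinant of a square block of relations among the `g i`
multiplies each of the generators involved into the span of the remaining ones. -/
lemma det_mul_mem_span_image_compl {S : Type*} [CommRing S] {n k : ℕ} (g : Fin n → S)
    (r : Fin k → Fin n → S) {ι : Fin k → Fin n} (hι : Function.Injective ι)
    (hr : ∀ l, ∑ i, r l i * g i = 0) (j : Fin k) :
    (Matrix.of fun a b ↦ r b (ι a)).det * g (ι j) ∈
      Ideal.span (g '' ((Finset.univ.image ι)ᶜ : Finset (Fin n))) := by
  set N := Ideal.span (g '' ((Finset.univ.image ι)ᶜ : Finset (Fin n)))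
  set A : Matrix (Fin k) (Fin k) S := Matrix.of fun a b ↦ r b (ι a) with hA
  have hvA (l : Fin k) : Matrix.vecMul (g ∘ ι) A l ∈ N := by
    have h1 : Matrix.vecMul (g ∘ ι) A l + ∑ i ∈ (Finset.univ.image ι)ᶜ, r l i * g i = 0 := by
      rw [← hr l, ← Finset.sum_add_sum_compl (Finset.univ.image ι),
        Finset.sum_image fun _ _ _ _ h ↦ hι h]
      simp [Matrix.vecMul, dotProduct, hA, mul_comm]
    rw [eq_neg_of_add_eq_zero_left h1]
    exact neg_mem (sum_mem fun i hi ↦ Ideal.mul_mem_left _ _ (Ideal.subset_span ⟨i, hi, rfl⟩))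
  have h2 : A.det * g (ι j) = Matrix.vecMul (Matrix.vecMul (g ∘ ι) A) A.adjugate j := by
    rw [Matrix.vecMul_vecMul, Matrix.mul_adjugate, Matrix.vecMul_smul, Matrix.vecMul_one]
    simp
  rw [h2, Matrix.vecMul, dotProduct]
  exact N.sum_mem fun l _ ↦ Ideal.mul_mem_right _ _ (hvA l)

lemma fittingIdeal_le_of_lt_minGens {S R : Type*} [CommRing S] [CommRing R] [Algebra S R]
    (p : Ideal S) [p.IsPrime] [IsLocalization.AtPrime R p] (I : Ideal S) {c : ℕ}
    (hc : (c : ℕ∞) < minGens (I.map (algebraMap S R))) : fittingIdeal S I c ≤ p := by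
  refine iSup_le fun n ↦ iSup_le fun g ↦ iSup_le fun hg ↦ Ideal.span_le.mpr ?_
  rintro _ ⟨r, ι, hr, rfl⟩
  by_contra hd
  have hι : Function.Injective ι := by
    intro a b hab
    by_contra hne
    refine hd ?_
    rw [Matrix.det_zero_of_row_eq hne (by ext l; simp [hab])]
    exact p.zero_mem
  have hunit : IsUnit (algebraMap S R (Matrix.of fun k l ↦ r l (ι k)).det) :=
    IsLocalization.map_units R (⟨_, hd⟩ : p.primeCompl)
  have hI : I = Ideal.span (Set.range fun i ↦ (g i : S)) := by
    have := congrArg (Submodule.map I.subtype) hg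
    rw [Submodule.map_span, Submodule.map_top, Submodule.range_subtype, ← Set.range_comp] at this
    exact this.symm
  set T : Finset (Fin n) := (Finset.univ.image ι)ᶜ with hT
  have hspan : I.map (algebraMap S R) =
      Ideal.span ((fun i ↦ algebraMap S R (g i)) '' T) := by
    apply le_antisymm
    · refine (Ideal.map_mono hI.le).trans ?_
      rw [Ideal.map_span, Ideal.span_le]
      rintro _ ⟨_, ⟨i, rfl⟩, rfl⟩
      by_cases hi : i ∈ T
      · exact Ideal.subset_span ⟨i, hi, rfl⟩
      · obtain ⟨j, rfl⟩ : ∃ j, ι j = i := by simpa [hT] using hi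
        have := Ideal.mem_map_of_mem (algebraMap S R) (det_mul_mem_span_image_compl
          (fun i ↦ (g i : S)) r hι (fun l ↦ by simpa using congrArg Subtype.val (hr l)) j)
        rw [map_mul, Ideal.unit_mul_mem_iff_mem _ hunit, Ideal.map_span, Set.image_image] at this
        exact this
    · rw [Ideal.span_le]
      rintro _ ⟨i, -, rfl⟩
      exact Ideal.mem_map_of_mem _ (g i).2
  refine hc.not_ge ?_
  rw [hspan]
  refine (minGens_span_finset_image_le T _).trans ?_
  rw [hT, Finset.card_compl, Finset.card_image_of_injective _ hι]
  simp only [Finset.card_univ, Fintype.card_fin]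
  norm_cast
  omega

theorem stmt4 {S : Type u} [CommRing S] [IsNoetherianRing S] (hCM : IsCohenMacaulayRing S)
    (I : Ideal S) (c : ℕ) (hunm : IsUnmixedOfHeight I c) (hgci : IsGenericallyCI I)
    (m : ℕ) (hm : 0 < m)
    (p : Ideal S) [hp : p.IsPrime]
    (hass : p ∈ associatedPrimes S (S ⧸ (I ^ m)))
    (hnass : p ∉ associatedPrimes S (S ⧸ I)) :
    fittingIdeal S ↥I c ≤ p ∧
      (c : ℕ∞) < minGens (I.map (algebraMap S (Localization.AtPrime p))) := by
  suffices h : (c : ℕ∞) < minGens (I.map (algebraMap S (Localization.AtPrime p))) from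
    ⟨fittingIdeal_le_of_lt_minGens p I h, h⟩
  by_contra hlt
  obtain ⟨r, f, hf, hr⟩ := minGens_le_iff.mp (not_lt.mp hlt)
  have hIp : I ≤ p := by
    have := IsAssociatedPrime.annihilator_le hass
    rw [Submodule.annihilator_top, Ideal.annihilator_quotient] at this
    exact hp.le_of_pow_le this
  have hcomap : (maximalIdeal (Localization.AtPrime p)).comap
      (algebraMap S (Localization.AtPrime p)) = p := Localization.AtPrime.under_maximalIdeal
  have hJ : Ideal.ofList (List.ofFn f) = I.map (algebraMap S (Localization.AtPrime p)) := by
    rw [← hf, Ideal.ofList]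
    congr 1
    ext x
    simp [List.mem_ofFn]
  have hJmax : I.map (algebraMap S (Localization.AtPrime p)) ≤
      maximalIdeal (Localization.AtPrime p) := by
    rw [Ideal.map_le_iff_le_comap, hcomap]
    exact hIp
  have hht : (c : ℕ∞) ≤ (I.map (algebraMap S (Localization.AtPrime p))).height := by
    rw [← hunm.1, ← IsLocalization.height_under p.primeCompl]
    exact (idealHeight_le_height I).trans (Ideal.height_mono Ideal.le_comap_map)
  have hreg : IsWeaklyRegular (Localization.AtPrime p) (List.ofFn f) := by
    refine isWeaklyRegular_of_length_le_height (hCM p hp) (fun y hy ↦ ?_) ?_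
    · exact hJmax (hJ ▸ Ideal.subset_span hy)
    · rw [hJ, List.length_ofFn]
      exact le_trans (by exact_mod_cast hr) hht
  have hmax : maximalIdeal (Localization.AtPrime p) ∈ associatedPrimes (Localization.AtPrime p)
      (Localization.AtPrime p ⧸ Ideal.ofList (List.ofFn f) ^ m) := by
    rw [hJ, ← Ideal.map_pow, mem_associatedPrimes_quotient_map_iff p.primeCompl, hcomap]
    exact hass
  obtain ⟨q, hq, hle⟩ := exists_le_mem_associatedPrimes_of_isWeaklyRegular hreg hmax
  rw [← (maximalIdeal.isMaximal _).eq_of_le hq.isPrime.ne_top hle, hJ,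
    mem_associatedPrimes_quotient_map_iff p.primeCompl, hcomap] at hq
  exact hnass hq
end

section
/- Let S be a Cohen–Macaulay Noetherian ring, let I be an unmixed ideal of S of height c that is generically a complete intersection, and let m be a positive integer. Then I^(m) = I^m if and only if the c-th Fitting ideal F_c(I) contains an element that is a nonzerodivisor on S/I^m. -/
open Ideal Filter

universe u

/-- `z` is a nonzerodivisor modulo `K`. -/
def RegularMod {R : Type*} [CommRing R] (K : Ideal R) (z : R) : Prop :=
  ∀ a, z * a ∈ K → a ∈ K

/-- There is a sequence of `n` elements of the ideal `𝔪` that is weakly regular on `R ⧸ K`. -/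
def HasRegularSeqMod {R : Type*} [CommRing R] (𝔪 : Ideal R) : Ideal R → ℕ → Prop
  | _, 0 => True
  | K, n + 1 => ∃ x ∈ 𝔪, RegularMod K x ∧ HasRegularSeqMod 𝔪 (K ⊔ span {x}) n

/-- For every ideal `L` containing `J`, elements regular modulo `L` stay regular on
`J ^ k ⧸ L * J ^ k`. -/
def PowersQuasiFree {R : Type*} [CommRing R] (J : Ideal R) : Prop :=
  ∀ L, J ≤ L → ∀ z, RegularMod L z → ∀ k, ∀ a ∈ J ^ k, z * a ∈ L * J ^ k → a ∈ L * J ^ k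

section RegularMod

variable {R : Type*} [CommRing R]

theorem isSMulRegular_quotient_iff_regularMod {K : Ideal R} {z : R} :
    IsSMulRegular (R ⧸ K) z ↔ RegularMod K z := by
  rw [isSMulRegular_iff_right_eq_zero_of_smul]
  constructor
  · intro h a ha
    rw [← Ideal.Quotient.eq_zero_iff_mem]
    apply h
    rwa [← Ideal.Quotient.mk_eq_mk, ← Submodule.Quotient.mk_smul, Ideal.Quotient.mk_eq_mk,
      Ideal.Quotient.eq_zero_iff_mem]
  · intro h a ha
    obtain ⟨a, rfl⟩ := Ideal.Quotient.mk_surjective a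
    rw [← Ideal.Quotient.mk_eq_mk, ← Submodule.Quotient.mk_smul, Ideal.Quotient.mk_eq_mk,
      Ideal.Quotient.eq_zero_iff_mem] at ha
    exact Ideal.Quotient.eq_zero_iff_mem.mpr (h a ha)

theorem mem_sup_span_singleton' {K : Ideal R} {x a : R} :
    a ∈ K ⊔ span {x} ↔ ∃ k ∈ K, ∃ b, a = k + x * b := by
  rw [Submodule.mem_sup]
  constructor
  · rintro ⟨k, hk, y, hy, rfl⟩
    obtain ⟨b, rfl⟩ := Ideal.mem_span_singleton'.mp hy
    exact ⟨k, hk, b, by ring⟩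
  · rintro ⟨k, hk, b, rfl⟩
    exact ⟨k, hk, x * b, Ideal.mul_mem_right _ _ (Ideal.mem_span_singleton_self x), rfl⟩

theorem RegularMod.swap {K : Ideal R} {x z : R} (hx : RegularMod K x)
    (hz : RegularMod (K ⊔ span {x}) z) : RegularMod (K ⊔ span {z}) x := by
  intro a ha
  obtain ⟨k, hk, b, hb⟩ := mem_sup_span_singleton'.mp ha
  have hb' : z * b ∈ K ⊔ span {x} :=
    mem_sup_span_singleton'.mpr ⟨-k, K.neg_mem hk, a, by linear_combination -hb⟩
  obtain ⟨k', hk', b', rfl⟩ := mem_sup_span_singleton'.mp (hz b hb')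
  have : a - z * b' ∈ K := hx _ (by
    have : x * (a - z * b') = k + z * k' := by linear_combination hb
    rw [this]
    exact K.add_mem hk (K.mul_mem_left _ hk'))
  exact mem_sup_span_singleton'.mpr ⟨_, this, b', by ring⟩

theorem socle_le_sup_span_of_regularMod {K 𝔪 : Ideal R} {x y : R} (hx𝔪 : x ∈ 𝔪)
    (hx : RegularMod K x) (hy : RegularMod K y)
    (h : ∀ a, (∀ z ∈ 𝔪, z * a ∈ K ⊔ span {x}) → a ∈ K ⊔ span {x}) :
    ∀ a, (∀ z ∈ 𝔪, z * a ∈ K ⊔ span {y}) → a ∈ K ⊔ span {y} := by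
  intro a ha
  obtain ⟨k, hk, b, hb⟩ := mem_sup_span_singleton'.mp (ha x hx𝔪)
  have hbx : b ∈ K ⊔ span {x} := by
    refine h b fun z hz => ?_
    obtain ⟨k', hk', e, he⟩ := mem_sup_span_singleton'.mp (ha z hz)
    have : z * b - x * e ∈ K := hy _ (by
      have : y * (z * b - x * e) = x * k' - z * k := by linear_combination x * he - z * hb
      rw [this]
      exact K.sub_mem (K.mul_mem_left _ hk') (K.mul_mem_left _ hk))
    exact mem_sup_span_singleton'.mpr ⟨_, this, e, by ring⟩
  obtain ⟨k', hk', e, rfl⟩ := mem_sup_span_singleton'.mp hbx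
  have : a - y * e ∈ K := hx _ (by
    have : x * (a - y * e) = k + y * k' := by linear_combination hb
    rw [this]
    exact K.add_mem hk (K.mul_mem_left _ hk'))
  exact mem_sup_span_singleton'.mpr ⟨_, this, e, by ring⟩

theorem mem_associatedPrimes_quotient_iff [IsNoetherianRing R] {K P : Ideal R} :
    P ∈ associatedPrimes R (R ⧸ K) ↔ P.IsPrime ∧ ∃ x, ∀ a, a ∈ P ↔ a * x ∈ K := by
  rw [AssociatedPrimes.mem_iff, isAssociatedPrime_iff]
  refine and_congr_right fun _ => ?_
  have key : ∀ x a : R, a ∈ (⊥ : Submodule R (R ⧸ K)).colon {Ideal.Quotient.mk K x} ↔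
      a * x ∈ K := by
    intro x a
    rw [Submodule.mem_colon_singleton, Submodule.mem_bot, ← Ideal.Quotient.mk_eq_mk,
      ← Submodule.Quotient.mk_smul, Ideal.Quotient.mk_eq_mk, Ideal.Quotient.eq_zero_iff_mem,
      smul_eq_mul]
  constructor
  · rintro ⟨x, rfl⟩
    obtain ⟨x, rfl⟩ := Ideal.Quotient.mk_surjective x
    exact ⟨x, key x⟩
  · rintro ⟨x, hx⟩
    exact ⟨Ideal.Quotient.mk K x, Ideal.ext fun a => (hx a).trans (key x a).symm⟩

theorem exists_associatedPrime_of_notMem [IsNoetherianRing R] {K : Ideal R} {x : R} (hx : x ∉ K) :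
    ∃ P ∈ associatedPrimes R (R ⧸ K), ∀ a, a * x ∈ K → a ∈ P := by
  obtain ⟨P, hP, h⟩ := exists_le_isAssociatedPrime_of_isNoetherianRing R (Ideal.Quotient.mk K x)
    (by rwa [Ne, Ideal.Quotient.eq_zero_iff_mem])
  refine ⟨P, hP, fun a ha => h ?_⟩
  rw [Submodule.mem_colon_singleton, Submodule.mem_bot, ← Ideal.Quotient.mk_eq_mk,
    ← Submodule.Quotient.mk_smul, Ideal.Quotient.mk_eq_mk, Ideal.Quotient.eq_zero_iff_mem]
  exact ha

theorem RegularMod.notMem_associatedPrime [IsNoetherianRing R] {K P : Ideal R} {z : R}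
    (hz : RegularMod K z) (hP : P ∈ associatedPrimes R (R ⧸ K)) : z ∉ P := by
  obtain ⟨hP, x, hx⟩ := mem_associatedPrimes_quotient_iff.mp hP
  intro h
  exact hP.ne_top ((Ideal.eq_top_iff_one _).mpr
    ((hx 1).mpr (by simpa using hz x ((hx z).mp h))))

theorem exists_mem_forall_regularMod [IsNoetherianRing R] (F : Ideal R) (T : Set (Ideal R))
    (hT : T.Finite) (h : ∀ K ∈ T, ∀ a, (∀ z ∈ F, z * a ∈ K) → a ∈ K) :
    ∃ z ∈ F, ∀ K ∈ T, RegularMod K z := by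
  have hfin : (⋃ K ∈ T, associatedPrimes R (R ⧸ K)).Finite :=
    hT.biUnion fun K _ => associatedPrimes.finite R (R ⧸ K)
  by_contra! hcon
  have hsub : (F : Set R) ⊆ ⋃ P ∈ (hfin.toFinset : Set (Ideal R)), (P : Set R) := by
    intro z hz
    obtain ⟨K, hK, hr⟩ := hcon z hz
    simp only [RegularMod, not_forall] at hr
    obtain ⟨a, ha, ha'⟩ := hr
    obtain ⟨P, hP, hle⟩ := exists_associatedPrime_of_notMem ha'
    refine Set.mem_biUnion (x := P) ?_ (hle z ha)
    rw [hfin.coe_toFinset]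
    exact Set.mem_biUnion hK hP
  rw [Ideal.subset_union_prime ⊥ ⊥ (f := fun P : Ideal R => P)] at hsub
  · obtain ⟨P, hP, hle⟩ := hsub
    rw [Set.Finite.mem_toFinset] at hP
    obtain ⟨K, hK, hP⟩ := Set.mem_iUnion₂.mp hP
    obtain ⟨hPp, x, hx⟩ := mem_associatedPrimes_quotient_iff.mp hP
    have := h K hK x fun z hz => (hx z).mp (hle hz)
    exact hPp.ne_top ((Ideal.eq_top_iff_one _).mpr ((hx 1).mpr (by simpa using this)))
  · intro P hP _ _
    rw [Set.Finite.mem_toFinset] at hP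
    obtain ⟨K, hK, hP⟩ := Set.mem_iUnion₂.mp hP
    exact (mem_associatedPrimes_quotient_iff.mp hP).1

theorem HasRegularSeqMod.sup_span [IsNoetherianRing R] {𝔪 : Ideal R} {n : ℕ} {K : Ideal R} {y : R}
    (h : HasRegularSeqMod 𝔪 K (n + 1)) (hy𝔪 : y ∈ 𝔪) (hy : RegularMod K y) :
    HasRegularSeqMod 𝔪 (K ⊔ span {y}) n := by
  induction n generalizing K y with
  | zero => trivial
  | succ n ih =>
    obtain ⟨x, hx𝔪, hx, hn⟩ := h
    obtain ⟨x', hx'𝔪, hx', -⟩ := id hn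
    have hsx : ∀ a, (∀ z ∈ 𝔪, z * a ∈ K ⊔ span {x}) → a ∈ K ⊔ span {x} :=
      fun a ha => hx' a (ha x' hx'𝔪)
    obtain ⟨z, hz𝔪, hz⟩ := exists_mem_forall_regularMod 𝔪 {K, K ⊔ span {x}, K ⊔ span {y}}
      (by simp) (by
        rintro L (rfl | rfl | rfl)
        · exact fun a ha => hx a (ha x hx𝔪)
        · exact hsx
        · exact socle_le_sup_span_of_regularMod hx𝔪 hx hy hsx)
    have hzK : RegularMod K z := hz _ (by simp)
    have hzx : RegularMod (K ⊔ span {x}) z := hz _ (by simp)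
    have hzy : RegularMod (K ⊔ span {y}) z := hz _ (by simp)
    refine ⟨z, hz𝔪, hzy, ?_⟩
    rw [sup_right_comm]
    refine ih ⟨x, hx𝔪, hx.swap hzx, ?_⟩ hy𝔪 (hy.swap hzy)
    rw [sup_right_comm]
    exact ih hn hz𝔪 hzx

end RegularMod

section PowersQuasiFree

variable {R : Type*} [CommRing R]

theorem powersQuasiFree_bot : PowersQuasiFree (⊥ : Ideal R) := by
  rintro L - z hz (_ | k) a ha hza
  · simpa using hz a (by simpa using hza)
  · have : a = 0 := by simpa using ha
    simp [this]

theorem PowersQuasiFree.regularMod_pow {J : Ideal R} (hJ : PowersQuasiFree J) {z : R}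
    (hz : RegularMod J z) (m : ℕ) : RegularMod (J ^ m) z := by
  induction m with
  | zero => intro a _; simp
  | succ m ih =>
    intro a ha
    rw [pow_succ'] at ha ⊢
    exact hJ J le_rfl z hz m a (ih a (Ideal.mul_le_right ha)) ha

theorem sup_span_pow_succ (J : Ideal R) (f : R) (k : ℕ) :
    (J ⊔ span {f}) ^ (k + 1) = J ^ (k + 1) ⊔ span {f} * (J ⊔ span {f}) ^ k := by
  apply le_antisymm
  · induction k with
    | zero => simp
    | succ k ih =>
      rw [pow_succ' _ (k + 1), Ideal.sup_mul]
      refine sup_le ?_ le_sup_right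
      calc J * (J ⊔ span {f}) ^ (k + 1)
          ≤ J * (J ^ (k + 1) ⊔ span {f} * (J ⊔ span {f}) ^ k) := Ideal.mul_mono_right ih
        _ = J ^ (k + 1 + 1) ⊔ span {f} * (J * (J ⊔ span {f}) ^ k) := by
            rw [Ideal.mul_sup, ← pow_succ', mul_left_comm]
        _ ≤ _ := by
            gcongr
            rw [pow_succ']
            gcongr
            exact le_sup_left
  · refine sup_le (Ideal.pow_right_mono le_sup_left _) ?_
    rw [pow_succ']
    gcongr
    exact le_sup_right

theorem PowersQuasiFree.sup_span {J : Ideal R} (hJ : PowersQuasiFree J) {f : R}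
    (hf : RegularMod J f) : PowersQuasiFree (J ⊔ span {f}) := by
  intro L hL z hz k
  have hJL : J ≤ L := le_sup_left.trans hL
  have hfL : f ∈ L := hL (Ideal.mem_sup_right (Ideal.mem_span_singleton_self f))
  induction k with
  | zero => intro a _ hza; simpa using hz a (by simpa using hza)
  | succ k ih =>
    have hLpow : L * (J ⊔ span {f}) ^ (k + 1) =
        L * J ^ (k + 1) ⊔ span {f} * (L * (J ⊔ span {f}) ^ k) := by
      rw [sup_span_pow_succ, Ideal.mul_sup, mul_left_comm]
    intro a ha hza
    rw [sup_span_pow_succ] at ha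
    obtain ⟨u, hu, y, hy, rfl⟩ := Submodule.mem_sup.mp ha
    obtain ⟨b, hb, rfl⟩ := Ideal.mem_span_singleton_mul.mp hy
    have hfpow := hJ.regularMod_pow hf (k + 1)
    have hJsub : J ^ (k + 1) ≤ L * (J ⊔ span {f}) ^ k := by
      rw [pow_succ']
      exact Ideal.mul_mono hJL (Ideal.pow_right_mono le_sup_left _)
    have hLJ : L * J ^ (k + 1) ≤ J ^ (k + 1) := Ideal.mul_le_right
    have hbL : b ∈ L * (J ⊔ span {f}) ^ k := by
      rw [hLpow] at hza
      obtain ⟨v, hv, y, hy, hvy⟩ := Submodule.mem_sup.mp hza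
      obtain ⟨w, hw, rfl⟩ := Ideal.mem_span_singleton_mul.mp hy
      refine ih b hb ?_
      have : z * b - w ∈ J ^ (k + 1) := hfpow _ (by
        have : f * (z * b - w) = v - z * u := by linear_combination -hvy
        rw [this]
        exact Ideal.sub_mem _ (hLJ hv) (Ideal.mul_mem_left _ _ hu))
      have := Ideal.add_mem _ (hJsub this) hw
      rwa [sub_add_cancel] at this
    have hfb : f * b ∈ L * (J ⊔ span {f}) ^ (k + 1) := by
      rw [hLpow]
      exact Ideal.mem_sup_right (Ideal.mul_mem_mul (Ideal.mem_span_singleton_self f) hbL)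
    have hzu : z * u ∈ L * (J ⊔ span {f}) ^ (k + 1) := by
      have := Ideal.sub_mem _ hza (Ideal.mul_mem_left _ z hfb)
      rwa [mul_add, add_sub_cancel_right] at this
    refine Ideal.add_mem _ ?_ hfb
    rw [hLpow] at hzu ⊢
    refine Ideal.mem_sup_left (hJ L hJL z hz (k + 1) u hu ?_)
    obtain ⟨v, hv, y, hy, hvy⟩ := Submodule.mem_sup.mp hzu
    obtain ⟨w, hw, rfl⟩ := Ideal.mem_span_singleton_mul.mp hy
    have : w ∈ J ^ (k + 1) := hfpow _ (by
      have : f * w = z * u - v := by linear_combination hvy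
      rw [this]
      exact Ideal.sub_mem _ (Ideal.mul_mem_left _ _ hu) (hLJ hv))
    rw [← hvy]
    exact Ideal.add_mem _ hv (Ideal.mul_mem_mul hfL this)

end PowersQuasiFree

section LocalRing

open RingTheory.Sequence

variable {R : Type*} [CommRing R]

theorem add_ringKrullDim_quotient_le {J : Ideal R} {c n : ℕ}
    (hJ : ∀ Q : PrimeSpectrum R, J ≤ Q.asIdeal → (c : ℕ∞) ≤ Order.height Q)
    (hn : (n : WithBot ℕ∞) ≤ ringKrullDim (R ⧸ J)) :
    ((c + n : ℕ) : WithBot ℕ∞) ≤ ringKrullDim R := by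
  rw [ringKrullDim_quotient, Order.le_krullDim_iff] at hn
  obtain ⟨l, hl⟩ := hn
  let l' : LTSeries (PrimeSpectrum R) := l.map Subtype.val fun _ _ h => h
  have h1 : ((c + n : ℕ) : ℕ∞) ≤ Order.height l'.head + Order.coheight l'.head := by
    rw [Nat.cast_add]
    refine add_le_add (hJ _ l.head.2) ?_
    rw [← hl]
    exact Order.length_le_coheight_head (p := l')
  have : Nonempty (PrimeSpectrum R) := ⟨l'.head⟩
  rw [ringKrullDim, Order.krullDim_eq_iSup_height_add_coheight_of_nonempty]
  exact_mod_cast h1.trans (le_iSup (fun a : PrimeSpectrum R => Order.height a + Order.coheight a) _)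

theorem ringKrullDim_quotient_eq_coheight (P : PrimeSpectrum R) :
    ringKrullDim (R ⧸ P.asIdeal) = Order.coheight P := by
  rw [ringKrullDim_quotient, Order.coheight_eq_krullDim_Ici]
  rfl

variable [IsLocalRing R] [IsNoetherianRing R]

theorem ringKrullDim_quotient_le_sup_span_add_one {K : Ideal R} (hK : K ≠ ⊤) {f : R}
    (hf : f ∈ IsLocalRing.maximalIdeal R) :
    ringKrullDim (R ⧸ K) ≤ ringKrullDim (R ⧸ (K ⊔ span {f})) + 1 := by
  have : Nontrivial (R ⧸ K) := Ideal.Quotient.nontrivial_iff.mpr hK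
  have : IsLocalRing (R ⧸ K) :=
    IsLocalRing.of_surjective' (Ideal.Quotient.mk K) Ideal.Quotient.mk_surjective
  have hmem : Ideal.Quotient.mk K f ∈ IsLocalRing.maximalIdeal (R ⧸ K) := by
    have hloc : IsLocalHom (Ideal.Quotient.mk K) :=
      .of_surjective _ Ideal.Quotient.mk_surjective
    exact (IsLocalRing.mem_maximalIdeal _).mpr fun hu =>
      (IsLocalRing.mem_maximalIdeal f).mp hf (isUnit_of_map_unit (Ideal.Quotient.mk K) f hu)
  have h := ringKrullDim_le_ringKrullDim_quotient_add_encard {Ideal.Quotient.mk K f}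
    (by simpa [IsLocalRing.ringJacobson_eq_maximalIdeal] using hmem)
  have e : (R ⧸ K) ⧸ span {Ideal.Quotient.mk K f} ≃+* R ⧸ (K ⊔ span {f}) :=
    (Ideal.quotEquivOfEq (by rw [Ideal.map_span, Set.image_singleton])).trans
      (DoubleQuot.quotQuotEquivQuotSup K (span {f}))
  rw [ringKrullDim_eq_of_ringEquiv e] at h
  simpa using h

theorem ringKrullDim_quotient_le_sup_ofList_add_length {K : Ideal R}
    (hK : K ≤ IsLocalRing.maximalIdeal R) (fs : List R)
    (hfs : ∀ f ∈ fs, f ∈ IsLocalRing.maximalIdeal R) :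
    ringKrullDim (R ⧸ K) ≤ ringKrullDim (R ⧸ (K ⊔ ofList fs)) + fs.length := by
  induction fs generalizing K with
  | nil => rw [ofList_nil, sup_bot_eq]; simp
  | cons f fs ih =>
    have hf := hfs f (by simp)
    have h1 := ringKrullDim_quotient_le_sup_span_add_one
      (ne_top_of_le_ne_top (IsLocalRing.maximalIdeal.isMaximal R).ne_top hK) hf
    have h2 := ih (K := K ⊔ span {f})
      (sup_le hK ((Ideal.span_singleton_le_iff_mem _).mpr hf)) fun g hg => hfs g (by simp [hg])
    rw [sup_assoc, ← ofList_cons] at h2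
    calc _ ≤ _ := h1
      _ ≤ _ := add_le_add_left h2 1
      _ = _ := by push_cast [List.length_cons]; rw [add_assoc]

theorem exists_associatedPrime_sup_span {K P : Ideal R} {x : R}
    (hx𝔪 : x ∈ IsLocalRing.maximalIdeal R) (hx : RegularMod K x)
    (hP : P ∈ associatedPrimes R (R ⧸ K)) :
    ∃ Q ∈ associatedPrimes R (R ⧸ (K ⊔ span {x})), P < Q := by
  have hxP := hx.notMem_associatedPrime hP
  obtain ⟨hPp, y, hy⟩ := mem_associatedPrimes_quotient_iff.mp hP
  let N : Ideal R :=
    { carrier := {a | ∀ p ∈ P, p * a ∈ K}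
      add_mem' := fun {a b} ha hb p hp => by rw [mul_add]; exact K.add_mem (ha p hp) (hb p hp)
      zero_mem' := fun p _ => by simp
      smul_mem' := fun c a ha p hp => by
        rw [smul_eq_mul, mul_left_comm]; exact K.mul_mem_left _ (ha p hp) }
  have hyN : y ∈ N := fun p hp => (hy p).mp hp
  have hyK : y ∉ K := fun h => hPp.ne_top ((Ideal.eq_top_iff_one _).mpr ((hy 1).mpr (by simpa)))
  have hNx : ¬ N ≤ K ⊔ span {x} := by
    intro hle
    refine hyK ((Submodule.le_of_le_smul_of_le_jacobson_bot (I := IsLocalRing.maximalIdeal R)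
      (IsNoetherian.noetherian N) (IsLocalRing.maximalIdeal_le_jacobson _) ?_ : N ≤ K) hyN)
    intro a ha
    obtain ⟨k, hk, b, rfl⟩ := mem_sup_span_singleton'.mp (hle ha)
    have hb : b ∈ N := fun p hp => hx _ (by
      have : x * (p * b) = p * (k + x * b) - p * k := by ring
      rw [this]
      exact K.sub_mem (ha p hp) (K.mul_mem_left _ hk))
    exact Submodule.add_mem_sup hk (Ideal.mul_mem_mul hx𝔪 hb)
  obtain ⟨a, haN, ha⟩ := SetLike.not_le_iff_exists.mp hNx
  obtain ⟨Q, hQ, hle⟩ := exists_associatedPrime_of_notMem ha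
  refine ⟨Q, hQ, SetLike.lt_iff_le_and_exists.mpr
    ⟨fun p hp => hle p (Ideal.mem_sup_left (haN p hp)), x, hle x ?_, hxP⟩⟩
  exact Ideal.mem_sup_right (Ideal.mul_mem_right _ _ (Ideal.mem_span_singleton_self x))

theorem HasRegularSeqMod.le_coheight {n : ℕ} {K : Ideal R}
    (h : HasRegularSeqMod (IsLocalRing.maximalIdeal R) K n) {P : PrimeSpectrum R}
    (hP : P.asIdeal ∈ associatedPrimes R (R ⧸ K)) : (n : ℕ∞) ≤ Order.coheight P := by
  induction n generalizing K P with
  | zero => simp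
  | succ n ih =>
    obtain ⟨x, hx𝔪, hx, hn⟩ := h
    obtain ⟨Q, hQ, hlt⟩ := exists_associatedPrime_sup_span hx𝔪 hx hP
    let Q' : PrimeSpectrum R := ⟨Q, (mem_associatedPrimes_quotient_iff.mp hQ).1⟩
    have := ih hn (P := Q') hQ
    refine le_trans ?_ (Order.coheight_add_one_le (show P < Q' from hlt))
    push_cast
    gcongr

theorem HasRegularSeqMod.regularMod_of_height_le {d n : ℕ} (hd : ringKrullDim R = d) {K : Ideal R}
    (hn : HasRegularSeqMod (IsLocalRing.maximalIdeal R) K n) {f : R} {fs : List R}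
    (hfs : ∀ g ∈ fs, g ∈ IsLocalRing.maximalIdeal R)
    (hht : ∀ Q : PrimeSpectrum R, K ⊔ ofList (f :: fs) ≤ Q.asIdeal →
      ((d + (fs.length + 1) : ℕ) : ℕ∞) ≤ Order.height Q + n) : RegularMod K f := by
  intro a hfa
  by_contra ha
  obtain ⟨P, hP, hle⟩ := exists_associatedPrime_of_notMem ha
  have hPp := (mem_associatedPrimes_quotient_iff.mp hP).1
  have hKP : K ≤ P := fun k hk => hle k (K.mul_mem_right _ hk)
  have h1 := hn.le_coheight (P := ⟨P, hPp⟩) hP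
  have h2 := ringKrullDim_quotient_le_sup_ofList_add_length
    (IsLocalRing.le_maximalIdeal hPp.ne_top) fs hfs
  rw [ringKrullDim_quotient_eq_coheight ⟨P, hPp⟩] at h2
  have h3 : (n : WithBot ℕ∞) ≤ ringKrullDim (R ⧸ (P ⊔ ofList fs)) + fs.length :=
    le_trans (by exact_mod_cast h1) h2
  have hJ : ∀ Q : PrimeSpectrum R, P ⊔ ofList fs ≤ Q.asIdeal →
      ((d + (fs.length + 1) : ℕ) : ℕ∞) ≤ Order.height Q + n := by
    intro Q hQ
    refine hht Q (le_trans ?_ hQ)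
    rw [ofList_cons]
    refine sup_le (hKP.trans le_sup_left) (sup_le ?_ le_sup_right)
    exact ((Ideal.span_singleton_le_iff_mem _).mpr (hle f hfa)).trans le_sup_left
  have hPtop : P ⊔ ofList fs ≤ IsLocalRing.maximalIdeal R :=
    sup_le (IsLocalRing.le_maximalIdeal hPp.ne_top) (Ideal.span_le.mpr hfs)
  have hQd : ∀ Q : PrimeSpectrum R, Order.height Q ≤ d := fun Q => by
    have := Order.height_le_krullDim Q
    rw [← ringKrullDim, hd] at this
    exact_mod_cast this
  have hlen : fs.length + 1 ≤ n := by
    have := (hJ ⟨_, (IsLocalRing.maximalIdeal.isMaximal R).isPrime⟩ hPtop).trans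
      (add_le_add_left (hQd _) _)
    norm_cast at this
    omega
  have h4 : ((n - fs.length : ℕ) : WithBot ℕ∞) ≤ ringKrullDim (R ⧸ (P ⊔ ofList fs)) := by
    clear hJ
    generalize ringKrullDim (R ⧸ (P ⊔ ofList fs)) = D at h3
    induction D using WithBot.recBotCoe with
    | bot => simp at h3
    | coe D =>
      induction D using ENat.recTopCoe with
      | top => exact_mod_cast le_top
      | coe D =>
        norm_cast at h3
        exact WithBot.coe_le_coe.mpr (Nat.cast_le.mpr (by omega))
  have h5 := add_ringKrullDim_quotient_le (c := d + (fs.length + 1) - n) (fun Q hQ => by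
    have := hJ Q hQ
    have hQ := hQd Q
    lift Order.height Q to ℕ using (ne_top_of_le_ne_top (ENat.natCast_ne_top d) hQ) with q
    norm_cast at this ⊢
    omega) h4
  rw [hd] at h5
  norm_cast at h5
  omega

theorem HasRegularSeqMod.sup_ofList {d : ℕ} (hd : ringKrullDim R = d) {fs : List R} {n : ℕ}
    {K : Ideal R} (hn : HasRegularSeqMod (IsLocalRing.maximalIdeal R) K n)
    (hK : PowersQuasiFree K) (hK𝔪 : K ≤ IsLocalRing.maximalIdeal R)
    (hfs : ∀ g ∈ fs, g ∈ IsLocalRing.maximalIdeal R)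
    (hht : ∀ Q : PrimeSpectrum R, K ⊔ ofList fs ≤ Q.asIdeal →
      ((d + fs.length : ℕ) : ℕ∞) ≤ Order.height Q + n) :
    PowersQuasiFree (K ⊔ ofList fs) ∧
      HasRegularSeqMod (IsLocalRing.maximalIdeal R) (K ⊔ ofList fs) (n - fs.length) := by
  induction fs generalizing K n with
  | nil => simpa using ⟨hK, hn⟩
  | cons f fs ih =>
    have hf := hfs f (by simp)
    have hfs' : ∀ g ∈ fs, g ∈ IsLocalRing.maximalIdeal R := fun g hg => hfs g (by simp [hg])
    have hreg := hn.regularMod_of_height_le hd hfs' hht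
    rw [ofList_cons, ← sup_assoc] at hht ⊢
    have hK𝔪' := sup_le hK𝔪 ((Ideal.span_singleton_le_iff_mem _).mpr hf)
    cases n with
    | zero =>
      have := hht ⟨_, (IsLocalRing.maximalIdeal.isMaximal R).isPrime⟩
        (sup_le hK𝔪' (Ideal.span_le.mpr hfs'))
      have h2 := Order.height_le_krullDim
        (⟨_, (IsLocalRing.maximalIdeal.isMaximal R).isPrime⟩ : PrimeSpectrum R)
      rw [← ringKrullDim, hd] at h2
      have h2 := this.trans (add_le_add_left (by exact_mod_cast h2) _)
      norm_cast at h2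
      simp at h2
    | succ n =>
      have := ih (hn.sup_span hf hreg) (hK.sup_span hreg) hK𝔪' hfs' fun Q hQ => by
        have := hht Q hQ
        rw [List.length_cons] at this
        push_cast at this ⊢
        rw [← add_assoc, ← add_assoc] at this
        exact (ENat.add_le_add_iff_right (by simp)).mp this
      simpa using this

omit [IsNoetherianRing R] in
theorem hasRegularSeqMod_of_isRegular {rs : List R} (h : IsRegular R rs) :
    HasRegularSeqMod (IsLocalRing.maximalIdeal R) ⊥ rs.length := by
  have hmem : ∀ x ∈ rs, x ∈ IsLocalRing.maximalIdeal R := by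
    have : ofList rs ≠ ⊤ := fun h' => h.top_ne_smul (by simp [h'])
    exact fun x hx => IsLocalRing.le_maximalIdeal this (Ideal.subset_span hx)
  have key : ∀ k i, i + k = rs.length →
      HasRegularSeqMod (IsLocalRing.maximalIdeal R) (ofList (rs.take i)) k := by
    intro k
    induction k with
    | zero => intros; trivial
    | succ k ih =>
      intro i hi
      have hi' : i < rs.length := by omega
      refine ⟨rs[i], hmem _ (List.getElem_mem hi'), ?_, ?_⟩
      · have hr := h.regular_mod_prev i hi'
        have htop : ofList (rs.take i) • (⊤ : Ideal R) = ofList (rs.take i) := by simp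
        rw [htop] at hr
        exact isSMulRegular_quotient_iff_regularMod.mp hr
      · have := ih (i + 1) (by omega)
        rwa [List.take_succ_eq_append_getElem hi', ofList_append, ofList_singleton] at this
  simpa using key rs.length 0 (by simp)

end LocalRing

section FittingIdeal

open RingTheory.Sequence

variable {S : Type*} [CommRing S]

theorem det_mem_fittingIdeal {M : Type*} [AddCommGroup M] [Module S M] {n t c : ℕ}
    (ht : n - c = t) {g : Fin n → M} (hg : Submodule.span S (Set.range g) = ⊤)
    (r : Fin t → Fin n → S) (ι : Fin t → Fin n) (hr : ∀ k, ∑ i, r k i • g i = 0) :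
    Matrix.det (Matrix.of fun k l => r l (ι k)) ∈ fittingIdeal S M c := by
  subst ht
  exact Ideal.mem_iSup_of_mem n (Ideal.mem_iSup_of_mem g (Ideal.mem_iSup_of_mem hg
    (Ideal.subset_span ⟨r, ι, hr, rfl⟩)))

theorem exists_ofList_eq_map_of_fittingIdeal_not_le {I P : Ideal S} [P.IsPrime] {c : ℕ}
    (h : ¬ fittingIdeal S I c ≤ P) :
    ∃ fs : List (Localization.AtPrime P), fs.length ≤ c ∧
      ofList fs = I.map (algebraMap S (Localization.AtPrime P)) := by
  simp only [fittingIdeal, iSup_le_iff, not_forall, Ideal.span_le] at h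
  obtain ⟨n, g, hg, h⟩ := h
  obtain ⟨d, ⟨r, ι, hr, rfl⟩, hd⟩ := Set.not_subset.mp h
  set A : Matrix (Fin (n - c)) (Fin (n - c)) S := Matrix.of fun k l => r l (ι k) with hA
  have hι : Function.Injective ι := by
    intro k k' hk
    by_contra hne
    refine hd ?_
    rw [Matrix.det_zero_of_row_eq hne (by ext l; simp [hA, hk])]
    exact P.zero_mem
  let T : Finset (Fin n) := (Finset.univ.image ι)ᶜ
  let gs : List S := T.toList.map fun i => (g i : S)
  have hgs : ∀ i ∈ T, (g i : S) ∈ ofList gs := fun i hi =>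
    Ideal.subset_span (List.mem_map.mpr ⟨i, Finset.mem_toList.mpr hi, rfl⟩)
  have hrow : ∀ l, ∑ k, A k l * (g (ι k) : S) ∈ ofList gs := by
    intro l
    have h0 : ∑ i, r l i * (g i : S) = 0 := by
      have := congrArg (Subtype.val : I → S) (hr l)
      simpa using this
    rw [← Finset.sum_add_sum_compl (Finset.univ.image ι), Finset.sum_image hι.injOn] at h0
    have h1 : ∑ k, A k l * (g (ι k) : S) = -∑ i ∈ T, r l i * (g i : S) :=
      eq_neg_of_add_eq_zero_left h0
    rw [h1]
    exact neg_mem (Ideal.sum_mem _ fun i hi => Ideal.mul_mem_left _ _ (hgs i hi))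
  have hdet : ∀ i, A.det * (g i : S) ∈ ofList gs := by
    intro i
    by_cases hi : i ∈ T
    · exact Ideal.mul_mem_left _ _ (hgs i hi)
    obtain ⟨k, rfl⟩ : ∃ k, ι k = i := by simpa [T] using hi
    have h2 : A.transpose.adjugate.mulVec (A.transpose.mulVec fun k => (g (ι k) : S)) k =
        A.det * (g (ι k) : S) := by
      rw [Matrix.mulVec_mulVec, Matrix.adjugate_mul, Matrix.det_transpose]
      simp [Matrix.smul_mulVec]
    rw [← h2, Matrix.mulVec, dotProduct]
    exact Ideal.sum_mem _ fun l _ => Ideal.mul_mem_left _ _ (hrow l)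
  refine ⟨gs.map (algebraMap S _), ?_, ?_⟩
  · simp only [gs, List.length_map, Finset.length_toList, T, Finset.card_compl,
      Finset.card_image_of_injective _ hι, Finset.card_univ, Fintype.card_fin]
    omega
  · rw [← map_ofList]
    apply le_antisymm
    · apply Ideal.map_mono
      refine Ideal.span_le.mpr fun x hx => ?_
      obtain ⟨i, -, rfl⟩ := List.mem_map.mp hx
      exact (g i).2
    · rw [Ideal.map_le_iff_le_comap]
      intro x hx
      have hx' : (⟨x, hx⟩ : I) ∈ Submodule.span S (Set.range g) := hg ▸ Submodule.mem_top
      obtain ⟨a, ha⟩ := (Submodule.mem_span_range_iff_exists_fun S).mp hx'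
      have hx'' : x = ∑ i, a i * (g i : S) := by
        have := congrArg (Subtype.val : I → S) ha
        simpa using this.symm
      have hxd : A.det * x ∈ ofList gs := by
        rw [hx'', Finset.mul_sum]
        refine Ideal.sum_mem _ fun i _ => ?_
        rw [mul_left_comm]
        exact Ideal.mul_mem_left _ _ (hdet i)
      have := Ideal.mem_map_of_mem (algebraMap S (Localization.AtPrime P)) hxd
      rw [map_mul] at this
      exact (Ideal.unit_mul_mem_iff_mem _
        (IsLocalization.map_units (Localization.AtPrime P) (⟨A.det, hd⟩ : P.primeCompl))).mp this

theorem mem_map_atPrime_iff {I P : Ideal S} [P.IsPrime] {x : S} :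
    algebraMap S (Localization.AtPrime P) x ∈ I.map (algebraMap S (Localization.AtPrime P)) ↔
      ∃ s ∉ P, s * x ∈ I := by
  rw [IsLocalization.algebraMap_mem_map_algebraMap_iff P.primeCompl]
  rfl

theorem exists_notMem_mul_mem_span {P : Ideal S} [P.IsPrime] {I : Ideal S} {c : ℕ}
    {rs : List (Localization.AtPrime P)} (hlen : rs.length ≤ c)
    (hrs : ofList rs = I.map (algebraMap S (Localization.AtPrime P))) :
    ∃ f : Fin c → I, ∀ x ∈ I, ∃ s ∉ P, s * x ∈ span (Set.range fun j => (f j : S)) := by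
  have hmem : ∀ j : Fin c, rs.getD j 0 ∈ I.map (algebraMap S (Localization.AtPrime P)) := by
    intro j
    rw [← hrs]
    by_cases hj : (j : ℕ) < rs.length
    · rw [List.getD_eq_getElem _ _ hj]
      exact Ideal.subset_span (List.getElem_mem hj)
    · rw [List.getD_eq_default _ _ (by omega)]
      exact Ideal.zero_mem _
  have hex : ∀ j : Fin c, ∃ f : I, ∃ s : P.primeCompl,
      rs.getD j 0 * algebraMap S (Localization.AtPrime P) s = algebraMap S _ f := by
    intro j
    obtain ⟨⟨f, s⟩, h⟩ := (IsLocalization.mem_map_algebraMap_iff P.primeCompl _).mp (hmem j)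
    exact ⟨f, s, h⟩
  choose f s hf using hex
  refine ⟨f, fun x hx => ?_⟩
  rw [← mem_map_atPrime_iff]
  have hle : I.map (algebraMap S (Localization.AtPrime P)) ≤
      (span (Set.range fun j => (f j : S))).map (algebraMap S (Localization.AtPrime P)) := by
    rw [← hrs]
    refine Ideal.span_le.mpr fun y hy => ?_
    obtain ⟨j, hj, rfl⟩ := List.getElem_of_mem hy
    have h1 := hf ⟨j, hj.trans_le hlen⟩
    rw [List.getD_eq_getElem _ _ hj] at h1
    refine (Ideal.mul_unit_mem_iff_mem _ (IsLocalization.map_units (Localization.AtPrime P)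
      (s ⟨j, hj.trans_le hlen⟩))).mp ?_
    rw [h1]
    exact Ideal.mem_map_of_mem _ (Ideal.subset_span ⟨_, rfl⟩)
  exact hle (Ideal.mem_map_of_mem _ hx)

theorem fittingIdeal_not_le_of_ofList_eq_map [IsNoetherianRing S] {P : Ideal S} [P.IsPrime]
    {I : Ideal S} {c : ℕ} {rs : List (Localization.AtPrime P)} (hlen : rs.length ≤ c)
    (hrs : ofList rs = I.map (algebraMap S (Localization.AtPrime P))) :
    ¬ fittingIdeal S I c ≤ P := by
  obtain ⟨f, hf⟩ := exists_notMem_mul_mem_span hlen hrs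
  obtain ⟨k, g, hg⟩ := Module.Finite.exists_fin (R := S) (M := I)
  have hex : ∀ i, ∃ s ∉ P, ∃ a : Fin c → S, ∑ j, a j • f j = s • g i := by
    intro i
    obtain ⟨s, hs, h⟩ := hf (g i) (g i).2
    obtain ⟨a, ha⟩ := (Submodule.mem_span_range_iff_exists_fun S).mp h
    exact ⟨s, hs, a, Subtype.ext (by simpa using ha)⟩
  choose s hs a ha using hex
  have hmem := det_mem_fittingIdeal (c := c) (n := c + k) (t := k) (by omega)
    (g := Fin.append f g) (top_le_iff.mp (hg.ge.trans (Submodule.span_mono (by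
      rintro _ ⟨i, rfl⟩
      exact ⟨Fin.natAdd c i, Fin.append_right f g i⟩))))
    (fun l => Fin.append (fun j => -a l j) (Pi.single l (s l))) (fun l => Fin.natAdd c l) (by
      intro l
      rw [Fin.sum_univ_add]
      simp [Pi.single_apply, ha])
  intro hle
  have hmem := hle hmem
  have hdiag : (Matrix.of fun k' l => Fin.append (fun j => -a l j)
      (Pi.single l (s l) : Fin k → S) (Fin.natAdd c k')) = Matrix.diagonal s := by
    ext k' l
    simp [Matrix.diagonal_apply, Pi.single_apply]
    grind
  rw [hdiag, Matrix.det_diagonal, Ideal.IsPrime.prod_mem_iff] at hmem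
  obtain ⟨i, -, hi⟩ := hmem
  exact hs i hi

end FittingIdeal

section Heights

open RingTheory.Sequence

variable {S : Type*} [CommRing S]

theorem idealHeight_eq_height_of_isPrime {p : Ideal S} [hp : p.IsPrime] :
    idealHeight p = p.height := by
  rw [PrimeSpectrum.height_eq_orderHeight ⟨p, hp⟩]
  exact le_antisymm (iInf₂_le (⟨p, hp⟩ : PrimeSpectrum S) le_rfl)
    (le_iInf₂ fun q hq => Order.height_mono hq)

theorem le_height_of_map_le {I P : Ideal S} [P.IsPrime] {c : ℕ∞} (hI : c ≤ idealHeight I)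
    (Q : PrimeSpectrum (Localization.AtPrime P))
    (hQ : I.map (algebraMap S (Localization.AtPrime P)) ≤ Q.asIdeal) : c ≤ Order.height Q := by
  rw [← PrimeSpectrum.height_eq_orderHeight, ← IsLocalization.height_under P.primeCompl]
  have hprime : (Q.asIdeal.under S).IsPrime := inferInstance
  rw [PrimeSpectrum.height_eq_orderHeight ⟨_, hprime⟩]
  exact hI.trans (iInf₂_le (⟨_, hprime⟩ : PrimeSpectrum S) (Ideal.map_le_iff_le_comap.mp hQ))

theorem exists_isRegular_length_eq_ringKrullDim {R : Type*} [CommRing R] [IsLocalRing R] {d : ℕ}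
    (hd : ringKrullDim R = d) (hCM : (localDepth R : WithBot ℕ∞) = ringKrullDim R) :
    ∃ rs : List R, IsRegular R rs ∧ rs.length = d := by
  rw [hd] at hCM
  have hdepth : localDepth R = d := by exact_mod_cast hCM
  have : Nonempty {rs : List R // (∀ x ∈ rs, x ∈ IsLocalRing.maximalIdeal R) ∧ IsRegular R rs} :=
    ⟨[], by simp, IsRegular.nil R R⟩
  obtain ⟨rs, hrs⟩ := ENat.exists_eq_iSup_of_lt_top
    (show localDepth R < ⊤ from hdepth ▸ ENat.natCast_lt_top d)
  exact ⟨rs.1, rs.2.2, by exact_mod_cast hrs.trans hdepth⟩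

theorem height_le_of_mem_associatedPrimes_pow [IsNoetherianRing S] (hCM : IsCohenMacaulayRing S)
    {I P : Ideal S} {c m : ℕ} (hI : (c : ℕ∞) ≤ idealHeight I)
    (hP : P ∈ associatedPrimes S (S ⧸ I ^ m)) (hF : ¬ fittingIdeal S I c ≤ P) :
    P.height ≤ c := by
  obtain ⟨hPp, y, hy⟩ := mem_associatedPrimes_quotient_iff.mp hP
  let R := Localization.AtPrime P
  obtain ⟨fs, hlen, hfs⟩ : ∃ fs : List R, fs.length ≤ c ∧ ofList fs = I.map (algebraMap S R) :=
    exists_ofList_eq_map_of_fittingIdeal_not_le hF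
  have hIP : I ≤ P := fun a ha => hPp.mem_of_pow_mem m
    ((hy _).mpr (Ideal.mul_mem_right _ _ (Ideal.pow_mem_pow ha m)))
  obtain ⟨d, hd⟩ := ENat.ne_top_iff_exists.mp (Ideal.height_ne_top_of_isPrime (I := P))
  have hdim : ringKrullDim R = d := by
    rw [IsLocalization.AtPrime.ringKrullDim_eq_height P R, ← hd]; rfl
  obtain ⟨rs, hreg, hrs⟩ := exists_isRegular_length_eq_ringKrullDim hdim (hCM P hPp)
  have hD := hasRegularSeqMod_of_isRegular hreg
  rw [hrs] at hD
  have hI𝔪 : I.map (algebraMap S R) ≤ IsLocalRing.maximalIdeal R := by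
    rw [← IsLocalization.AtPrime.map_eq_maximalIdeal P R]
    exact Ideal.map_mono hIP
  obtain ⟨hfree, hdepth⟩ := hD.sup_ofList hdim powersQuasiFree_bot bot_le
    (fs := fs) (fun g hg => hI𝔪 (hfs ▸ Ideal.subset_span hg)) (by
      intro Q hQ
      rw [bot_sup_eq, hfs] at hQ
      rw [add_comm, Nat.cast_add]
      gcongr
      exact le_trans (by exact_mod_cast hlen) (le_height_of_map_le hI Q hQ))
  rw [bot_sup_eq, hfs] at hfree hdepth
  rw [← hd]
  by_contra! hlt
  have hlt : c < d := by exact_mod_cast hlt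
  obtain ⟨e, he⟩ : ∃ e, d - fs.length = e + 1 := ⟨d - fs.length - 1, by omega⟩
  rw [he] at hdepth
  obtain ⟨z, hz𝔪, hz, -⟩ := hdepth
  have hPy : ∀ z ∈ IsLocalRing.maximalIdeal R,
      z * algebraMap S R y ∈ (I ^ m).map (algebraMap S R) := by
    intro z hz
    rw [← IsLocalization.AtPrime.map_eq_maximalIdeal P R] at hz
    have := Ideal.mul_mem_mul hz (Ideal.mem_map_of_mem (algebraMap S R)
      (Ideal.mem_span_singleton_self y))
    rw [← Ideal.map_mul] at this
    refine Ideal.map_mono (Ideal.mul_le.mpr fun a ha b hb => ?_) this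
    obtain ⟨b, rfl⟩ := Ideal.mem_span_singleton'.mp hb
    rw [mul_left_comm]
    exact Ideal.mul_mem_left _ _ ((hy a).mp ha)
  have hzy := hPy z hz𝔪
  rw [Ideal.map_pow] at hzy
  have hyI := hfree.regularMod_pow hz m _ hzy
  rw [← Ideal.map_pow] at hyI
  obtain ⟨s, hs, hsy⟩ := mem_map_atPrime_iff.mp hyI
  exact hs ((hy s).mpr hsy)

theorem mem_associatedPrimes_of_height_le [IsNoetherianRing S] {I P : Ideal S} [P.IsPrime]
    (hIP : I ≤ P) (hh : P.height ≤ idealHeight I) : P ∈ associatedPrimes S (S ⧸ I) := by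
  apply Module.associatedPrimes.minimalPrimes_annihilator_subset_associatedPrimes S (S ⧸ I)
  rw [Ideal.annihilator_quotient]
  refine Ideal.mem_minimalPrimes_of_height_le hIP (hh.trans ?_)
  rw [Ideal.height_eq_inf_minimalPrimes]
  refine le_iInf₂ fun Q hQ => ?_
  rw [PrimeSpectrum.height_eq_orderHeight ⟨Q, hQ.isPrime⟩]
  exact iInf₂_le (⟨Q, hQ.isPrime⟩ : PrimeSpectrum S) hQ.1.2

theorem mem_symbolicPower_iff {I : Ideal S} {m : ℕ} {x : S} :
    x ∈ symbolicPower I m ↔ ∀ p ∈ associatedPrimes S (S ⧸ I), ∃ s ∉ p, s * x ∈ I ^ m := by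
  simp only [symbolicPower, Ideal.mem_iInf, Subtype.forall, Ideal.mem_comap]
  refine forall₂_congr fun p hp => ?_
  have : p.IsPrime := hp.1
  exact mem_map_atPrime_iff

theorem length_le_of_isRegular_atPrime [IsNoetherianRing S] {P : Ideal S} [P.IsPrime] {c : ℕ}
    (hP : P.height = c) {rs : List (Localization.AtPrime P)}
    (h : IsRegular (Localization.AtPrime P) rs) : rs.length ≤ c := by
  have hdim := ringKrullDim_add_length_eq_ringKrullDim_of_isRegular rs h
  rw [IsLocalization.AtPrime.ringKrullDim_eq_height P (Localization.AtPrime P), hP] at hdim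
  have : Nontrivial (Localization.AtPrime P ⧸ ofList rs) :=
    Ideal.Quotient.nontrivial_iff.mpr fun htop => h.top_ne_smul (by simp [htop])
  have hle := hdim ▸ le_add_of_nonneg_left (a := (rs.length : WithBot ℕ∞))
    (ringKrullDim_nonneg_of_nontrivial (R := Localization.AtPrime P ⧸ ofList rs))
  exact_mod_cast hle

end Heights

theorem stmt6 {S : Type u} [CommRing S] [IsNoetherianRing S] (hCM : IsCohenMacaulayRing S)
    (I : Ideal S) (c : ℕ) (hunm : IsUnmixedOfHeight I c) (hgci : IsGenericallyCI I)
    (m : ℕ) (hm : 0 < m) :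
    symbolicPower I m = I ^ m ↔
      ∃ g ∈ fittingIdeal S ↥I c, IsSMulRegular (S ⧸ (I ^ m)) g := by
  constructor
  · intro heq
    obtain ⟨g, hg, hreg⟩ := exists_mem_forall_regularMod (fittingIdeal S I c) {I ^ m} (by simp) (by
      rintro _ rfl a ha
      rw [← heq, mem_symbolicPower_iff]
      intro p hp
      have : p.IsPrime := hp.1
      obtain ⟨rs, hrs, hspan⟩ := hgci ⟨p, hp⟩
      have hht : p.height = c := idealHeight_eq_height_of_isPrime.symm.trans (hunm.2 p hp)
      obtain ⟨s, hs, hsp⟩ := SetLike.not_le_iff_exists.mp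
        (fittingIdeal_not_le_of_ofList_eq_map (length_le_of_isRegular_atPrime hht hrs) hspan)
      exact ⟨s, hsp, ha s hs⟩)
    exact ⟨g, hg, isSMulRegular_quotient_iff_regularMod.mpr (hreg _ rfl)⟩
  · rintro ⟨g, hg, hreg⟩
    rw [isSMulRegular_quotient_iff_regularMod] at hreg
    apply le_antisymm
    · intro x hx
      by_contra hxI
      obtain ⟨P, hP, hle⟩ := exists_associatedPrime_of_notMem hxI
      have hPp : P.IsPrime := hP.1
      have hF : ¬ fittingIdeal S I c ≤ P := fun h => hreg.notMem_associatedPrime hP (h hg)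
      have hht := height_le_of_mem_associatedPrimes_pow hCM hunm.1.ge hP hF
      have hIP : I ≤ P := fun a ha => hPp.mem_of_pow_mem m
        (hle _ (Ideal.mul_mem_right _ _ (Ideal.pow_mem_pow ha m)))
      obtain ⟨s, hs, hsx⟩ := mem_symbolicPower_iff.mp hx P
        (mem_associatedPrimes_of_height_le hIP (hht.trans hunm.1.ge))
      exact hs (hle s hsx)
    · intro x hx
      rw [mem_symbolicPower_iff]
      intro p hp
      exact ⟨1, fun h => hp.1.ne_top ((Ideal.eq_top_iff_one p).mpr h), by simpa using hx⟩
end
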